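/- arXiv:math/0112136 — 2 statements merged into one kernel-verified Lean document; each statement's English description precedes it below -/
import Mathlib

section
/- Assume CH. Let B be a Boolean algebra of cardinality continuum with 𝔯(B) > ω, i.e., for every countable family R of nonzero elements of B there exists a nonzero A ∈ B that splits every member of R (meaning A ⊓ R ≠ ⊥ and Aᶜ ⊓ R ≠ ⊥ for all R ∈ R). Then there is a subset D of the Stone space St(B) of cardinality ℵ₁ such that D is G_δ-dense in St(B) (D meets every nonempty G_δ subset of St(B)) and every countable subset of D is discrete in its subspace topology. -/
/-- A point of the Stone space of a Boolean algebra `B`: a Boolean algebra homomorphism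
`B → Bool`, viewed as an element of the product space `B → Bool`. -/
def IsStonePoint (B : Type) [BooleanAlgebra B] (f : B → Bool) : Prop :=
  f ⊥ = false ∧ f ⊤ = true ∧ (∀ a b : B, f (a ⊓ b) = (f a && f b)) ∧
    ∀ a b : B, f (a ⊔ b) = (f a || f b)

/-- The Stone space of a Boolean algebra `B`: the set of Boolean algebra homomorphisms
`B → Bool`, topologized as a subspace of the product space `B → Bool` (`Bool` discrete). -/
abbrev StoneSpace (B : Type) [BooleanAlgebra B] : Type :=
  {f : B → Bool // IsStonePoint B f}

open Set Cardinal

namespace StoneSpace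

variable {B : Type} [BooleanAlgebra B]

theorem apply_finset_inf {ι : Type*} (f : StoneSpace B) (t : Finset ι) (g : ι → B) :
    f.1 (t.inf g) = true ↔ ∀ i ∈ t, f.1 (g i) = true := by
  classical
  induction t using Finset.induction_on with
  | empty => simpa using f.2.2.1
  | insert a t _ ih => rw [Finset.inf_insert, f.2.2.2.1, Bool.and_eq_true, ih, Finset.forall_mem_insert]

theorem apply_compl (f : StoneSpace B) (b : B) : f.1 bᶜ = !f.1 b := by
  have hinf := f.2.2.2.1 b bᶜ
  have hsup := f.2.2.2.2 b bᶜ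
  rw [inf_compl_eq_bot, f.2.1] at hinf
  rw [sup_compl_eq_top, f.2.2.1] at hsup
  generalize f.1 b = x, f.1 bᶜ = y at hinf hsup ⊢
  revert hinf hsup x y
  decide

/-- A family with the finite intersection property extends to an ultrafilter. -/
theorem exists_forall_apply_eq_true {T : Set B}
    (hT : ∀ t : Finset B, ↑t ⊆ T → t.inf id ≠ ⊥) :
    ∃ f : StoneSpace B, ∀ b ∈ T, f.1 b = true := by
  classical
  have hF : Order.IsPFilter {b : B | ∃ t : Finset B, ↑t ⊆ T ∧ t.inf id ≤ b} := by
    refine Order.IsPFilter.of_def ⟨⊤, ∅, by simp, le_top⟩ ?_ ?_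
    · rintro a ⟨s, hs, hsa⟩ b ⟨t, ht, htb⟩
      refine ⟨(s ∪ t).inf id, ⟨s ∪ t, by simp [hs, ht], le_rfl⟩, ?_, ?_⟩
      · exact (Finset.inf_mono Finset.subset_union_left).trans hsa
      · exact (Finset.inf_mono Finset.subset_union_right).trans htb
    · rintro a b hab ⟨t, ht, hta⟩
      exact ⟨t, ht, hta.trans hab⟩
  have hdisj : Disjoint (hF.toPFilter : Set B) ((⊥ : Order.Ideal B) : Set B) := by
    rw [Set.disjoint_left]
    rintro b ⟨t, ht, htb⟩ hb
    have hb' : b = ⊥ := le_bot_iff.1 hb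
    exact hT t ht (le_bot_iff.1 (hb' ▸ htb))
  obtain ⟨J, hJ, -, hFJ⟩ := DistribLattice.prime_ideal_of_disjoint_filter_ideal hdisj
  have htop : (⊤ : B) ∉ J := hJ.toIsProper.top_notMem
  refine ⟨⟨fun b => decide (b ∉ J), by simp, by simpa using htop, fun a b => ?_, fun a b => ?_⟩,
    fun b hb => ?_⟩
  · have : a ⊓ b ∈ J ↔ a ∈ J ∨ b ∈ J :=
      ⟨hJ.mem_or_mem, fun h => h.elim (J.lower inf_le_left) (J.lower inf_le_right)⟩
    simp [this]
  · simp only [Order.Ideal.sup_mem_iff, not_and_or, Bool.decide_or]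
  · have : b ∈ hF.toPFilter := ⟨{b}, by simpa using hb, by simp⟩
    simpa using Set.disjoint_left.1 hFJ this

theorem isOpen_apply_eq_true (b : B) : IsOpen {f : StoneSpace B | f.1 b = true} :=
  (isOpen_discrete ({true} : Set Bool)).preimage
    ((continuous_apply b).comp continuous_subtype_val : Continuous fun f : StoneSpace B => f.1 b)

theorem exists_clopen_subset {U : Set (StoneSpace B)} (hU : IsOpen U) {f : StoneSpace B}
    (hf : f ∈ U) : ∃ b : B, f.1 b = true ∧ ∀ g : StoneSpace B, g.1 b = true → g ∈ U := by
  obtain ⟨V, hV, rfl⟩ := isOpen_induced_iff.1 hU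
  obtain ⟨E, u, hu, hEV⟩ := isOpen_pi_iff.1 hV f.1 hf
  refine ⟨E.inf fun b => if f.1 b then b else bᶜ, ?_, fun g hg => hEV fun b hb => ?_⟩
  · rw [apply_finset_inf]
    intro b _
    cases h : f.1 b <;> simp [h, apply_compl]
  · have hgb := (apply_finset_inf g _ _).1 hg b hb
    have : g.1 b = f.1 b := by
      cases h : f.1 b <;> simp_all [apply_compl]
    exact this ▸ (hu b hb).2

theorem exists_seq_subset_of_isGδ {G : Set (StoneSpace B)} (hG : IsGδ G) {f : StoneSpace B}
    (hf : f ∈ G) : ∃ s : ℕ → B, (∀ n, f.1 (s n) = true) ∧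
      ∀ g : StoneSpace B, (∀ n, g.1 (s n) = true) → g ∈ G := by
  obtain ⟨U, hU, rfl⟩ := isGδ_iff_eq_iInter_nat.1 hG
  choose s hs hsU using fun n => exists_clopen_subset (hU n) (mem_iInter.1 hf n)
  exact ⟨s, hs, fun g hg => mem_iInter.2 fun n => hsU n g (hg n)⟩

end StoneSpace

section Splitting

variable {B W : Type} [BooleanAlgebra B] [LinearOrder W]

/-- The elements available below `γ`: those of rank below `γ`, and the values of `A` below `γ`
together with their complements. -/
def earlier (r : B → W) (A : W → B) (γ : W) : Set B :=
  {b | r b < γ} ∪ (A '' Iio γ ∪ (fun δ => (A δ)ᶜ) '' Iio γ)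

/-- `A γ` splits all nonzero finite meets of elements available below `γ`. -/
def SplitsEarlier (r : B → W) (A : W → B) : Prop :=
  ∀ (γ : W) (t : Finset B), ↑t ⊆ earlier r A γ → t.inf id ≠ ⊥ →
    A γ ⊓ t.inf id ≠ ⊥ ∧ (A γ)ᶜ ⊓ t.inf id ≠ ⊥

theorem exists_splitsEarlier [WellFoundedLT W] (hW : ∀ γ : W, (Iio γ).Countable)
    (hr : ∀ R : Set B, R.Countable → (∀ r ∈ R, r ≠ ⊥) →
      ∃ A : B, A ≠ ⊥ ∧ ∀ r ∈ R, A ⊓ r ≠ ⊥ ∧ Aᶜ ⊓ r ≠ ⊥)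
    (r : B → W) (hinj : r.Injective) : ∃ A : W → B, SplitsEarlier r A := by
  classical
  have hsplit : ∀ T : Set B, ∃ a : B, T.Countable → ∀ t : Finset B, ↑t ⊆ T → t.inf id ≠ ⊥ →
      a ⊓ t.inf id ≠ ⊥ ∧ aᶜ ⊓ t.inf id ≠ ⊥ := by
    intro T
    by_cases hT : T.Countable
    · have : Countable T := hT.to_subtype
      obtain ⟨a, -, ha⟩ := hr
        ((range fun t : Finset T => (t.map (Function.Embedding.subtype _)).inf id) \ {⊥})
        ((countable_range _).mono sdiff_subset) (fun _ h => h.2)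
      refine ⟨a, fun _ t ht hne => ha _ ⟨⟨t.subtype (· ∈ T), ?_⟩, hne⟩⟩
      change (Finset.map _ (Finset.subtype _ t)).inf id = _
      rw [Finset.subtype_map_of_mem fun x hx => ht hx]
    · exact ⟨⊥, fun h => absurd h hT⟩
  choose split hsplit using hsplit
  let step (γ : W) (ih : ∀ δ, δ < γ → B) : B := split ({b | r b < γ} ∪
    ((range fun δ : Iio γ => ih δ δ.2) ∪ range fun δ : Iio γ => (ih δ δ.2)ᶜ))
  let A : W → B := wellFounded_lt.fix step
  have hA : ∀ γ, A γ = split (earlier r A γ) := by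
    intro γ
    have : A γ = step γ fun δ _ => A δ := wellFounded_lt.fix_eq step γ
    rw [this, earlier, image_eq_range, image_eq_range]
  refine ⟨A, fun γ t ht hne => ?_⟩
  rw [hA]
  refine hsplit _ ?_ t ht hne
  exact ((hW γ).preimage_of_injOn hinj.injOn).union
    (((hW γ).image _).union ((hW γ).image _))

theorem SplitsEarlier.inf_ne_bot {r : B → W} {A : W → B} (hA : SplitsEarlier r A) {δ : W}
    {t : Finset B} (htδ : ∀ b ∈ t, r b < δ) (ht : t.inf id ≠ ⊥) (P : W → Prop) [DecidablePred P]
    (u : Finset W) (hu : ∀ γ ∈ u, δ ≤ γ) :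
    t.inf id ⊓ u.inf (fun γ => if P γ then A γ else (A γ)ᶜ) ≠ ⊥ := by
  classical
  induction u using Finset.induction_on_max with
  | empty => simpa using ht
  | insert a u hau ih =>
    have hu' := ih fun γ hγ => hu γ (Finset.mem_insert_of_mem hγ)
    have hsub : ↑(t ∪ u.image fun γ => if P γ then A γ else (A γ)ᶜ) ⊆ earlier r A a := by
      intro b hb
      simp only [Finset.coe_union, Finset.coe_image, mem_union, mem_image, Finset.mem_coe] at hb
      rcases hb with hb | ⟨γ, hγ, rfl⟩
      · exact Or.inl ((htδ b hb).trans_le (hu a (Finset.mem_insert_self _ _)))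
      · refine Or.inr ?_
        split_ifs
        · exact Or.inl ⟨γ, hau γ hγ, rfl⟩
        · exact Or.inr ⟨γ, hau γ hγ, rfl⟩
    have key := hA a _ hsub
    rw [Finset.inf_union, Finset.inf_image, Function.id_comp] at key
    rw [Finset.inf_insert, inf_left_comm]
    split_ifs
    · exact (key hu').1
    · exact (key hu').2

/-- Any family with the finite intersection property and ranks below `δ` is contained
in an ultrafilter whose trace on `A` above `δ` is prescribed. -/
theorem SplitsEarlier.exists_stonePoint {r : B → W} {A : W → B} (hA : SplitsEarlier r A) {δ : W}
    {s : Set B} (hsδ : ∀ b ∈ s, r b < δ) (hs : ∀ t : Finset B, ↑t ⊆ s → t.inf id ≠ ⊥)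
    (P : W → Prop) :
    ∃ f : StoneSpace B, (∀ b ∈ s, f.1 b = true) ∧ ∀ γ, δ ≤ γ → (f.1 (A γ) = true ↔ P γ) := by
  classical
  obtain ⟨f, hf⟩ := StoneSpace.exists_forall_apply_eq_true
    (T := s ∪ (fun γ => if P γ then A γ else (A γ)ᶜ) '' Ici δ) (by
      intro t ht
      have hsub : ↑(t.filter (· ∉ s)) ⊆ (fun γ => if P γ then A γ else (A γ)ᶜ) '' Ici δ := by
        intro b hb
        have hb := Finset.mem_filter.1 hb
        exact (ht hb.1).resolve_left hb.2
      obtain ⟨u, hu, hut⟩ := Finset.subset_set_image_iff.1 hsub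
      have hts : ↑(t.filter (· ∈ s)) ⊆ s := fun b hb => (Finset.mem_filter.1 hb).2
      have := hA.inf_ne_bot (fun b hb => hsδ b (hts hb)) (hs _ hts) P u hu
      rw [← Finset.filter_union_filter_not_eq (· ∈ s) t, Finset.inf_union, ← hut,
        Finset.inf_image, Function.id_comp]
      exact this)
  refine ⟨f, fun b hb => hf b (Or.inl hb), fun γ hγ => ?_⟩
  have h := hf _ (Or.inr ⟨γ, hγ, rfl⟩)
  by_cases hP : P γ
  · simpa [hP] using h
  · simpa [hP, StoneSpace.apply_compl] using h

end Splitting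

/-- In an uncountable linear order with countable initial segments, countable sets are strictly
bounded. -/
theorem exists_forall_lt_of_countable {W : Type} [LinearOrder W] [Uncountable W]
    (hW : ∀ γ : W, (Iic γ).Countable) {s : Set W} (hs : s.Countable) : ∃ δ, ∀ γ ∈ s, γ < δ := by
  by_contra! h
  refine not_countable_univ ((hs.biUnion fun γ _ => hW γ).mono fun δ _ => ?_)
  obtain ⟨γ, hγ, hδ⟩ := h δ
  exact mem_biUnion hγ hδ

theorem exists_map_cofinal_fibers {W : Type} [LinearOrder W] [Uncountable W]
    (hW : ∀ γ : W, (Iic γ).Countable) : ∃ p : W → W, ∀ β δ, ∃ γ, δ ≤ γ ∧ p γ = β := by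
  obtain ⟨e⟩ : Nonempty (W ≃ W × W) := Cardinal.eq.1 (by simp [mul_eq_self (aleph0_le_mk W)])
  refine ⟨fun γ => (e γ).1, fun β δ => ?_⟩
  by_contra! h
  refine not_countable_univ (α := W) (MapsTo.countable_of_injOn (t := Iic δ)
    (f := fun α => e.symm (β, α)) (fun α _ => ?_) ?_ (hW δ))
  · by_contra hlt
    exact h (e.symm (β, α)) (not_le.1 hlt).le (by simp)
  · intro a _ b _ hab
    simpa using hab

/-- Assuming CH, if `B` is a Boolean algebra of cardinality continuum with `𝔯(B) > ω`,
then its Stone space has a `G_δ`-dense subset of size `ℵ₁` all of whose countable subsets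
are relatively discrete. -/
theorem gdelta_dense_discrete_set_of_CH (hCH : Cardinal.continuum = Cardinal.aleph 1)
    (B : Type) [BooleanAlgebra B] (hB : Cardinal.mk B = Cardinal.continuum)
    (hr : ∀ R : Set B, R.Countable → (∀ r ∈ R, r ≠ ⊥) →
      ∃ A : B, A ≠ ⊥ ∧ ∀ r ∈ R, A ⊓ r ≠ ⊥ ∧ Aᶜ ⊓ r ≠ ⊥) :
    ∃ D : Set (StoneSpace B), Cardinal.mk ↥D = Cardinal.aleph 1 ∧
      (∀ G : Set (StoneSpace B), IsGδ G → G.Nonempty → (D ∩ G).Nonempty) ∧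
      ∀ S : Set (StoneSpace B), S ⊆ D → S.Countable → DiscreteTopology ↥S := by
  have hCH₀ : (continuum : Cardinal.{0}) = aleph 1 := by
    have h := congrArg lift.{0} hCH
    rw [lift_continuum, lift_aleph] at h
    rw [← lift_inj, lift_continuum, lift_aleph, Ordinal.lift_one]
    simpa using h
  let W := (aleph 1).ord.ToType
  have hWcard : #W = aleph 1 := by simp [W]
  have hIic : ∀ γ : W, (Iic γ).Countable := fun γ => by
    rw [← le_aleph0_iff_set_countable, ← lt_aleph_one_iff]
    simpa [W] using mk_Iic_lt γ (by simp [W]) (by simp [W])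
  have : Uncountable W := by
    rw [← aleph0_lt_mk_iff, hWcard]
    exact aleph0_lt_aleph_one
  have : Nontrivial B := by
    rw [← one_lt_iff_nontrivial, hB]
    exact one_lt_aleph0.trans aleph0_lt_continuum
  obtain ⟨e⟩ : Nonempty (B ≃ W) := Cardinal.eq.1 (by rw [hB, hCH₀, hWcard])
  obtain ⟨A, hA⟩ := exists_splitsEarlier (fun γ => (hIic γ).mono Iio_subset_Iic_self) hr e
    e.injective
  obtain ⟨p, hp⟩ := exists_map_cofinal_fibers hIic
  let I := {s : ℕ → B // ∃ f : StoneSpace B, ∀ n, f.1 (s n) = true}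
  obtain ⟨f₀, -⟩ := StoneSpace.exists_forall_apply_eq_true (B := B) (T := ∅) (by
    intro t ht
    have : t = ∅ := by simpa using ht
    simp [this])
  have : Nonempty I := ⟨⟨fun _ => ⊤, f₀, fun _ => f₀.2.2.1⟩⟩
  obtain ⟨s, hs⟩ : ∃ s : W → I, s.Surjective := by
    have hle : #I ≤ #W := (mk_subtype_le _).trans (by simp [hB, hWcard, ← hCH₀])
    obtain ⟨i⟩ := hle
    exact ⟨_, Function.invFun_surjective i.injective⟩
  choose δ hδ using fun β =>
    exists_forall_lt_of_countable hIic (countable_range fun n => e ((s β).1 n))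
  have hpoint : ∀ β, ∃ f : StoneSpace B, (∀ b ∈ range (s β).1, f.1 b = true) ∧
      ∀ γ, δ β ≤ γ → (f.1 (A γ) = true ↔ p γ = β) := fun β => by
    obtain ⟨f, hf⟩ := (s β).2
    refine hA.exists_stonePoint ?_ (fun t ht h => ?_) _
    · rintro _ ⟨n, rfl⟩
      exact hδ β _ ⟨n, rfl⟩
    · have := (f.apply_finset_inf t id).2 fun b hb => by
        obtain ⟨n, rfl⟩ := ht hb
        exact hf n
      rw [h, f.2.1] at this
      exact Bool.false_ne_true this
  choose x hxs hxA using hpoint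
  have hsep : ∀ C : Set W, C.Countable → ∀ β ∈ C, ∃ b : B,
      ∀ β' ∈ C, ((x β').1 b = true ↔ β' = β) := by
    intro C hC β _
    obtain ⟨η, hη⟩ := exists_forall_lt_of_countable hIic (hC.image δ)
    obtain ⟨γ, hγ, rfl⟩ := hp β η
    refine ⟨A γ, fun β' hβ' => ?_⟩
    rw [hxA β' γ ((hη _ ⟨β', hβ', rfl⟩).le.trans hγ), eq_comm]
  have hxinj : x.Injective := fun β β' h => by
    obtain ⟨b, hb⟩ := hsep {β, β'} (by simp) β (by simp)
    have hβ := (hb β (by simp)).2 rfl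
    rw [h] at hβ
    exact ((hb β' (by simp)).1 hβ).symm
  refine ⟨range x, by rw [mk_range_eq x hxinj, hWcard], ?_, ?_⟩
  · rintro G hG ⟨f, hf⟩
    obtain ⟨c, hfc, hcG⟩ := StoneSpace.exists_seq_subset_of_isGδ hG hf
    obtain ⟨β, hβ⟩ := hs ⟨c, f, hfc⟩
    refine ⟨x β, ⟨β, rfl⟩, hcG _ fun n => hxs β _ ⟨n, ?_⟩⟩
    rw [hβ]
  · intro S hSD hS
    rw [discreteTopology_iff_isOpen_singleton]
    rintro ⟨y, hy⟩
    obtain ⟨β, rfl⟩ := hSD hy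
    obtain ⟨b, hb⟩ := hsep (x ⁻¹' S) (hS.preimage_of_injOn hxinj.injOn) β hy
    convert (StoneSpace.isOpen_apply_eq_true b).preimage continuous_subtype_val
    ext ⟨z, hz⟩
    obtain ⟨β', rfl⟩ := hSD hz
    simpa [hxinj.eq_iff] using (hb β' hz).symm
end

section
/- Assume CH. There is a family (K_i)_{i ∈ I}, indexed by a set I of cardinality continuum, of closed subsets of ℕ* such that: each K_i is a nonempty P-set in ℕ*; each K_i is separable (has a countable dense subset); each K_i is rigid (the only homeomorphism of K_i onto itself is the identity); and for i ≠ j the spaces K_i and K_j are not homeomorphic. -/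
/-- `ℕ*`: the Čech–Stone remainder of the discrete space `ℕ`, i.e. the subspace of the
space of ultrafilters on `ℕ` consisting of the nonprincipal ultrafilters. -/
abbrev NStar : Type :=
  {u : Ultrafilter ℕ // ∀ n : ℕ, u ≠ pure n}

/-- A closed subset `K` of a topological space is a P-set if for every countable family of
open sets each containing `K`, `K` is contained in the interior of their intersection. -/
def IsPSet {X : Type*} [TopologicalSpace X] (K : Set X) : Prop :=
  IsClosed K ∧ ∀ U : ℕ → Set X, (∀ n, IsOpen (U n) ∧ K ⊆ U n) → K ⊆ interior (⋂ n, U n)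

open Set Filter Topology Cardinal

/-- A chain meeting `ℵ₁` many dense sets of a `σ`-closed preorder. -/
theorem exists_chain_meeting {P : Type*} [Preorder P] [Nonempty P]
    (hσ : ∀ f : ℕ → P, Monotone f → ∃ q, ∀ n, f n ≤ q)
    {ι : Type} (hι : #ι ≤ ℵ₁) (D : ι → Set P) (hD : ∀ i p, ∃ q ∈ D i, p ≤ q) :
    ∃ g : ι → P, (∀ i, g i ∈ D i) ∧ ∀ i j, g i ≤ g j ∨ g j ≤ g i := by
  classical
  obtain ⟨r, wo, hr⟩ := exists_ord_eq ι
  have hcount : ∀ i, {j | r j i}.Countable := by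
    intro i
    rw [← Set.countable_coe_iff, ← Cardinal.mk_le_aleph0_iff]
    have h : #{j | r j i} < #ι := by
      have := Ordinal.typein_lt_type r i
      rw [← hr, lt_ord] at this
      exact this
    rw [← Order.lt_succ_iff, Cardinal.succ_aleph0]
    exact h.trans_le hι
  have wf : WellFounded r := wo.wf
  let F : ∀ i, (∀ j, r j i → P) → P := fun i f =>
    if h : ∃ q ∈ D i, ∀ j (hj : r j i), f j hj ≤ q then h.choose else Classical.arbitrary P
  let g : ι → P := wf.fix F
  have spec : ∀ i, g i ∈ D i ∧ ∀ j, r j i → g j ≤ g i := by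
    intro i
    induction i using wf.induction with
    | _ i ih =>
    have hex : ∃ q ∈ D i, ∀ j, r j i → g j ≤ q := by
      have hub : ∃ q, ∀ j, r j i → g j ≤ q := by
        rcases isEmpty_or_nonempty {j | r j i} with he | hne
        · exact ⟨Classical.arbitrary P, fun j hj => (he.false ⟨j, hj⟩).elim⟩
        have : Countable {j | r j i} := (hcount i).to_subtype
        have : Encodable {j | r j i} := Encodable.ofCountable _
        have : Inhabited {j | r j i} := ⟨hne.some⟩
        have hdir : Directed (· ≤ ·) (fun j : {j | r j i} => g j) := by
          rintro ⟨a, ha⟩ ⟨b, hb⟩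
          rcases trichotomous_of r a b with h | h | h
          · exact ⟨⟨b, hb⟩, (ih b hb).2 a h, le_rfl⟩
          · subst h; exact ⟨⟨a, ha⟩, le_rfl, le_rfl⟩
          · exact ⟨⟨a, ha⟩, le_rfl, (ih a ha).2 b h⟩
        obtain ⟨q, hq⟩ := hσ _ hdir.sequence_mono
        exact ⟨q, fun j hj => (hdir.le_sequence ⟨j, hj⟩).trans (hq _)⟩
      obtain ⟨q, hq⟩ := hub
      obtain ⟨q', hq', hle⟩ := hD i q
      exact ⟨q', hq', fun j hj => (hq j hj).trans hle⟩
    have hgi : g i = hex.choose := by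
      change wf.fix F i = _
      rw [wf.fix_eq]
      exact dif_pos hex
    rw [hgi]
    exact hex.choose_spec
  refine ⟨g, fun i => (spec i).1, fun i j => ?_⟩
  rcases trichotomous_of r i j with h | h | h
  · exact .inl ((spec j).2 i h)
  · subst h; exact .inl le_rfl
  · exact .inr ((spec i).2 j h)

/-- A decreasing sequence of sets, all of whose terms have infinite intersection with each of
countably many sets `x k`, has a pseudo-intersection with the same property. -/
theorem exists_pseudoIntersection (d : ℕ → Set ℕ) (hd : Antitone d) (x : ℕ → Set ℕ)
    (h : ∀ n k, (x k ∩ d n).Infinite) :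
    ∃ e : Set ℕ, (∀ n, (e \ d n).Finite) ∧ ∀ k, (x k ∩ e).Infinite := by
  obtain ⟨q, hq, hqx⟩ := extraction_forall_of_frequently
    (P := fun j m => m ∈ x j.unpair.1 ∩ d j)
    (fun j => Nat.frequently_atTop_iff_infinite.2 (h j j.unpair.1))
  refine ⟨range q, fun n => ?_, fun k => ?_⟩
  · refine ((finite_lt_nat n).image q).subset ?_
    rintro _ ⟨⟨j, rfl⟩, hj⟩
    refine ⟨j, ?_, rfl⟩
    by_contra hjn
    exact hj (hd (not_lt.1 hjn) (hqx j).2)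
  · have hinj : Function.Injective fun m => q (Nat.pair k m) := fun a b hab => by
      simpa using hq.injective hab
    refine (infinite_range_of_injective hinj).mono ?_
    rintro _ ⟨m, rfl⟩
    exact ⟨by simpa using (hqx (Nat.pair k m)).1, _, rfl⟩

/-- Countably many infinite subsets of `ℕ` are split by a single set. -/
theorem exists_splitting (x : ℕ → Set ℕ) (h : ∀ k, (x k).Infinite) :
    ∃ a : Set ℕ, ∀ k, (x k ∩ a).Infinite ∧ (x k \ a).Infinite := by
  obtain ⟨q, hq, hqx⟩ := extraction_forall_of_frequently
    (P := fun j m => m ∈ x j.unpair.1)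
    (fun j => Nat.frequently_atTop_iff_infinite.2 (h j.unpair.1))
  refine ⟨range fun p : ℕ × ℕ => q (Nat.pair p.1 (2 * p.2)), fun k => ⟨?_, ?_⟩⟩
  · have hinj : Function.Injective fun m => q (Nat.pair k (2 * m)) := fun a b hab => by
      simpa using hq.injective hab
    refine (infinite_range_of_injective hinj).mono ?_
    rintro _ ⟨m, rfl⟩
    exact ⟨by simpa using hqx (Nat.pair k (2 * m)), (k, m), rfl⟩
  · have hinj : Function.Injective fun m => q (Nat.pair k (2 * m + 1)) := fun a b hab => by
      simpa using hq.injective hab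
    refine (infinite_range_of_injective hinj).mono ?_
    rintro _ ⟨m, rfl⟩
    refine ⟨by simpa using hqx (Nat.pair k (2 * m + 1)), ?_⟩
    rintro ⟨⟨a, b⟩, hab⟩
    have := hq.injective hab
    rw [Nat.pair_eq_pair] at this
    simp only at this
    lia

/-- `u` is a free ultrafilter all of whose countable subfamilies have a pseudo-intersection
in `u`. -/
def IsPPoint (u : Ultrafilter ℕ) : Prop :=
  (∀ a : Set ℕ, a.Finite → a ∉ u) ∧
    ∀ a : ℕ → Set ℕ, (∀ n, a n ∈ u) → ∃ b ∈ u, ∀ n, (b \ a n).Finite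

/-- Infinite subsets of `ℕ`, preordered by reverse almost inclusion. -/
def InfiniteSet : Type := {x : Set ℕ // x.Infinite}

theorem Set.Finite.sdiff_trans {α : Type*} {x y z : Set α} (h : (x \ y).Finite)
    (h' : (y \ z).Finite) : (x \ z).Finite :=
  (h.union h').subset fun n hn => by
    by_cases hy : n ∈ y
    · exact .inr ⟨hy, hn.2⟩
    · exact .inl ⟨hn.1, hy⟩

instance : Preorder InfiniteSet where
  le x y := (y.1 \ x.1).Finite
  le_refl x := by simp
  le_trans _ _ _ h h' := h'.sdiff_trans h

instance : Nonempty InfiniteSet := ⟨⟨univ, infinite_univ⟩⟩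

theorem InfiniteSet.exists_upperBound (f : ℕ → InfiniteSet) (hf : Monotone f) :
    ∃ q, ∀ n, f n ≤ q := by
  let d : ℕ → Set ℕ := fun n => ⋂ i ≤ n, (f i).1
  have hd : Antitone d := fun m n hmn => biInter_subset_biInter_left fun i hi => le_trans hi hmn
  have hfd : ∀ n, ((f n).1 \ d n).Finite := by
    intro n
    refine ((finite_le_nat n).biUnion (t := fun i => (f n).1 \ (f i).1)
      fun i hi => hf hi).subset ?_
    rintro m ⟨hm, hmd⟩
    simp only [d, mem_iInter, not_forall] at hmd
    obtain ⟨i, hi, hmi⟩ := hmd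
    exact mem_biUnion hi ⟨hm, hmi⟩
  obtain ⟨e, he, hinf⟩ := exists_pseudoIntersection d hd (fun _ => univ) (fun n _ => by
    rw [univ_inter]
    exact fun hfin => (f n).2 ((hfin.union (hfd n)).subset fun m hm => by
      by_cases h : m ∈ d n
      · exact .inl h
      · exact .inr ⟨hm, h⟩))
  refine ⟨⟨e, by simpa using hinf 0⟩, fun n => (he n).subset fun m hm => ⟨hm.1, fun h => hm.2 ?_⟩⟩
  simp only [d, mem_iInter] at h
  exact h n le_rfl

theorem mk_natSeq_set (hCH : continuum.{0} = ℵ₁) : #(ℕ → Set ℕ) = ℵ₁ := by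
  rw [← hCH]; simp

theorem mk_natSeq_nat (hCH : continuum.{0} = ℵ₁) : #(ℕ → ℕ) = ℵ₁ := by
  rw [← hCH]; simp

/-- Under CH, a P-point can be found outside any family of at most `ℵ₁` ultrafilters. -/
theorem exists_isPPoint_ne (hCH : continuum.{0} = ℵ₁) {ι : Type} (hι : #ι ≤ ℵ₁)
    (v : ι → Ultrafilter ℕ) : ∃ u, IsPPoint u ∧ ∀ i, u ≠ v i := by
  obtain ⟨g, hgD, hgc⟩ := exists_chain_meeting InfiniteSet.exists_upperBound
    (ι := (ℕ → Set ℕ) ⊕ ι)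
    (by
      rw [mk_sum, lift_id, lift_id, mk_natSeq_set hCH]
      exact (add_le_add le_rfl hι).trans (add_eq_self (aleph0_le_aleph 1)).le)
    (Sum.elim (fun a => {x | (∃ n, (x.1 ∩ a n).Finite) ∨ ∀ n, (x.1 \ a n).Finite})
      (fun i => {x | x.1 ∉ v i}))
    (by
      rintro (a | i) p
      · by_cases h : ∀ n, (p.1 \ a n).Finite
        · exact ⟨p, .inr h, le_rfl⟩
        · push Not at h
          obtain ⟨n, hn⟩ := h
          refine ⟨⟨p.1 \ a n, hn⟩, .inl ⟨n, ?_⟩, ?_⟩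
          · simp
          · exact (finite_empty).subset (by rintro m ⟨hm, hm'⟩; exact hm' hm.1)
      · obtain ⟨a, ha⟩ := exists_splitting (fun _ => p.1) (fun _ => p.2)
        by_cases h : p.1 ∩ a ∈ v i
        · refine ⟨⟨p.1 \ a, (ha 0).2⟩, fun h' => ?_, ?_⟩
          · have := (v i).inter_sets h h'
            have he : p.1 ∩ a ∩ (p.1 \ a) = ∅ := by ext; simp; tauto
            exact (v i).empty_notMem (he ▸ this)
          · exact (finite_empty).subset (by rintro m ⟨hm, hm'⟩; exact hm' hm.1)
        · exact ⟨⟨p.1 ∩ a, (ha 0).1⟩, h,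
            (finite_empty).subset (by rintro m ⟨hm, hm'⟩; exact hm' hm.1)⟩)
  let S : Set (Set ℕ) := {a | ∃ i, ((g i).1 \ a).Finite}
  have hS_inter : ∀ a ∈ S, ∀ b ∈ S, a ∩ b ∈ S := by
    rintro a ⟨i, hi⟩ b ⟨j, hj⟩
    rcases hgc i j with h | h
    · refine ⟨j, ?_⟩
      rw [sdiff_inter]
      exact (Set.Finite.sdiff_trans h hi).union hj
    · refine ⟨i, ?_⟩
      rw [sdiff_inter]
      exact hi.union (Set.Finite.sdiff_trans h hj)
  have hSfin : ∀ a ∈ S, a.Infinite := by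
    rintro a ⟨i, hi⟩ hfin
    exact (g i).2 ((hfin.union hi).subset fun m hm => by
      by_cases h : m ∈ a
      · exact .inl h
      · exact .inr ⟨hm, h⟩)
  have hS_mono : ∀ a ∈ S, ∀ b, a ⊆ b → b ∈ S := by
    rintro a ⟨i, hi⟩ b hab
    exact ⟨i, hi.subset (sdiff_subset_sdiff_right hab)⟩
  have hS_or : ∀ a, a ∈ S ∨ aᶜ ∈ S := by
    intro a
    rcases hgD (.inl fun _ => a) with ⟨_, h⟩ | h
    · exact .inr ⟨_, by rwa [sdiff_compl]⟩
    · exact .inl ⟨_, h 0⟩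
  let F : Filter ℕ :=
    { sets := S
      univ_sets := by
        rcases hS_or univ with h | h
        · exact h
        · exact hS_mono _ h _ (subset_univ _)
      sets_of_superset := fun ha hab => hS_mono _ ha _ hab
      inter_sets := fun ha hb => hS_inter _ ha _ hb }
  let u : Ultrafilter ℕ := Ultrafilter.ofComplNotMemIff F (fun s => by
    constructor
    · intro h
      rcases hS_or s with h' | h'
      · exact h'
      · exact (h h').elim
    · intro h h'
      have := hSfin _ (hS_inter _ h _ h')
      simp at this)
  refine ⟨u, ⟨fun a ha hau => hSfin a hau ha, fun a ha => ?_⟩, fun i hi => ?_⟩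
  · refine ⟨(g (.inl a)).1, ⟨.inl a, by simp⟩, ?_⟩
    rcases hgD (.inl a) with ⟨n, h⟩ | h
    · refine absurd ?_ (hSfin _ (hS_inter _ (ha n) _ (⟨.inl a, ?_⟩ : (a n)ᶜ ∈ S)))
      · simp
      · rwa [sdiff_compl]
    · exact h
  · have h1 : (g (.inr i)).1 ∉ v i := hgD (.inr i)
    rw [← hi] at h1
    exact h1 ⟨.inr i, by simp⟩

/-- Under CH there are `ℵ₁` many P-points, no two of which are Rudin–Keisler equivalent. -/
theorem exists_isPPoint_family (hCH : continuum.{0} = ℵ₁) {J : Type} (hJ : #J ≤ ℵ₁) :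
    ∃ u : J → Ultrafilter ℕ, (∀ j, IsPPoint (u j)) ∧
      ∀ i j, (∃ f : ℕ → ℕ, (u i).map f = u j) → (∃ f : ℕ → ℕ, (u j).map f = u i) → i = j := by
  let r : J → J → Prop := WellOrderingRel
  have wf : WellFounded r := WellOrderingRel.isWellOrder.wf
  have key : ∀ (j : J) (f : ∀ i, r i j → Ultrafilter ℕ), ∃ u, IsPPoint u ∧
      ∀ i (hi : r i j) (φ : ℕ → ℕ), u ≠ (f i hi).map φ := by
    intro j f
    obtain ⟨u, hu, hne⟩ := exists_isPPoint_ne hCH (ι := {i // r i j} × (ℕ → ℕ))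
      (by
        rw [mk_prod, lift_id, lift_id, mk_natSeq_nat hCH]
        exact (mul_le_mul' ((mk_subtype_le _).trans hJ) le_rfl).trans
          (mul_eq_self (aleph0_le_aleph 1)).le)
      (fun p => (f p.1.1 p.1.2).map p.2)
    exact ⟨u, hu, fun i hi φ => hne (⟨i, hi⟩, φ)⟩
  choose F hFP hF using key
  let u : J → Ultrafilter ℕ := wf.fix F
  have hu : ∀ j, u j = F j fun i _ => u i := fun j => wf.fix_eq F j
  have hlt : ∀ i j, r i j → ∀ φ : ℕ → ℕ, (u i).map φ ≠ u j := fun i j hij φ h =>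
    hF j (fun i _ => u i) i hij φ (by rw [← hu, h])
  refine ⟨u, fun j => by rw [hu]; exact hFP _ _, ?_⟩
  rintro i j ⟨f, hf⟩ ⟨f', hf'⟩
  rcases trichotomous_of r i j with h | h | h
  · exact (hlt i j h f hf).elim
  · exact h
  · exact (hlt j i h f' hf').elim

/-- Every two countable subsets of `B`, the first below the second, are separated by an element
of `B`. -/
def CountablySeparated (B : Type*) [LE B] : Prop :=
  ∀ S T : Set B, S.Countable → T.Countable → (∀ s ∈ S, ∀ t ∈ T, s ≤ t) →
    ∃ b, (∀ s ∈ S, s ≤ b) ∧ ∀ t ∈ T, b ≤ t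

/-- The graph of a homomorphism into `B` from a countable subalgebra of `Set ℕ` which vanishes on
finite sets. -/
structure PartialHom (B : Type*) [BooleanAlgebra B] where
  /-- The underlying graph. -/
  graph : Set (Set ℕ × B)
  countable : graph.Countable
  bot_mem : (∅, ⊥) ∈ graph
  compl_mem : ∀ x ∈ graph, xᶜ ∈ graph
  sup_mem : ∀ x ∈ graph, ∀ y ∈ graph, x ⊔ y ∈ graph
  eq_bot : ∀ x ∈ graph, x.1.Finite → x.2 = ⊥

namespace PartialHom

variable {B : Type} [BooleanAlgebra B]

instance : Preorder (PartialHom B) := Preorder.lift graph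

theorem le_def {R S : PartialHom B} : R ≤ S ↔ R.graph ⊆ S.graph := Iff.rfl

theorem inf_mem (R : PartialHom B) {x y : Set ℕ × B} (hx : x ∈ R.graph) (hy : y ∈ R.graph) :
    x ⊓ y ∈ R.graph := by
  have := R.compl_mem _ (R.sup_mem _ (R.compl_mem _ hx) _ (R.compl_mem _ hy))
  rwa [← compl_inf, compl_compl] at this

theorem sdiff_mem (R : PartialHom B) {x y : Set ℕ × B} (hx : x ∈ R.graph) (hy : y ∈ R.graph) :
    x \ y ∈ R.graph := by
  rw [_root_.sdiff_eq]
  exact R.inf_mem hx (R.compl_mem _ hy)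

theorem top_mem (R : PartialHom B) : (Set.univ, ⊤) ∈ R.graph := by
  have := R.compl_mem _ R.bot_mem
  rwa [show ((∅, ⊥) : Set ℕ × B)ᶜ = (Set.univ, ⊤) by ext <;> simp] at this

theorem le_of_finite (R : PartialHom B) {x y : Set ℕ × B} (hx : x ∈ R.graph) (hy : y ∈ R.graph)
    (h : (x.1 \ y.1).Finite) : x.2 ≤ y.2 := by
  have := R.eq_bot _ (R.sdiff_mem hx hy) h
  exact sdiff_eq_bot_iff.1 this

theorem ext_of_fst (R : PartialHom B) {a : Set ℕ} {b c : B} (hb : (a, b) ∈ R.graph)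
    (hc : (a, c) ∈ R.graph) : b = c :=
  le_antisymm (R.le_of_finite hb hc (by simp)) (R.le_of_finite hc hb (by simp))

instance : Nonempty (PartialHom B) :=
  ⟨{ graph := {(∅, ⊥), (Set.univ, ⊤)}
     countable := (Set.toFinite _).countable
     bot_mem := by simp
     compl_mem := by
      rintro x (rfl | rfl)
      · right; ext <;> simp
      · left; ext <;> simp
     sup_mem := by
      rintro x (rfl | rfl) y (rfl | rfl)
      · left; ext <;> simp
      · right; ext <;> simp
      · right; ext <;> simp
      · right; ext <;> simp
     eq_bot := by
      rintro x (rfl | rfl) h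
      · rfl
      · exact (infinite_univ h).elim }⟩

theorem exists_upperBound (f : ℕ → PartialHom B) (hf : Monotone f) : ∃ q, ∀ n, f n ≤ q := by
  refine ⟨{ graph := ⋃ n, (f n).graph
            countable := countable_iUnion fun n => (f n).countable
            bot_mem := mem_iUnion.2 ⟨0, (f 0).bot_mem⟩
            compl_mem := ?_
            sup_mem := ?_
            eq_bot := ?_ }, fun n => le_def.2 (subset_iUnion (fun n => (f n).graph) n)⟩
  · intro x hx
    obtain ⟨n, hn⟩ := mem_iUnion.1 hx
    exact mem_iUnion.2 ⟨n, (f n).compl_mem _ hn⟩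
  · intro x hx y hy
    obtain ⟨n, hn⟩ := mem_iUnion.1 hx
    obtain ⟨m, hm⟩ := mem_iUnion.1 hy
    exact mem_iUnion.2 ⟨max n m, (f _).sup_mem _ (hf (le_max_left n m) hn) _
      (hf (le_max_right n m) hm)⟩
  · intro x hx
    obtain ⟨n, hn⟩ := mem_iUnion.1 hx
    exact (f n).eq_bot x hn

/-- The criterion for adjoining a pair `(a, b)` to a partial homomorphism. -/
theorem exists_extension (R : PartialHom B) (c : Set ℕ × B)
    (h₁ : ∀ x ∈ R.graph, (x.1 ∩ c.1).Finite → x.2 ⊓ c.2 = ⊥)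
    (h₂ : ∀ x ∈ R.graph, (x.1 \ c.1).Finite → x.2 \ c.2 = ⊥) :
    ∃ S, R ≤ S ∧ c ∈ S.graph := by
  let F : (Set ℕ × B) × (Set ℕ × B) → Set ℕ × B := fun p => (p.1 ⊓ c) ⊔ (p.2 \ c)
  have hcompl : ∀ x y, (F (x, y))ᶜ = F (xᶜ, yᶜ) := by
    intro x y
    simp only [F]
    symm
    rw [eq_compl_iff_isCompl, isCompl_iff, disjoint_iff, codisjoint_iff]
    constructor
    · rw [_root_.sdiff_eq, _root_.sdiff_eq]
      simp only [inf_sup_left, inf_sup_right]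
      have e1 : xᶜ ⊓ c ⊓ (x ⊓ c) = ⊥ := by
        rw [inf_inf_inf_comm]; simp
      have e2 : yᶜ ⊓ cᶜ ⊓ (x ⊓ c) = ⊥ := by
        rw [inf_inf_inf_comm]; simp
      have e3 : xᶜ ⊓ c ⊓ (y ⊓ cᶜ) = ⊥ := by
        rw [inf_inf_inf_comm]; simp
      have e4 : yᶜ ⊓ cᶜ ⊓ (y ⊓ cᶜ) = ⊥ := by
        rw [inf_inf_inf_comm]; simp
      rw [e1, e2, e3, e4]; simp
    · have : xᶜ ⊓ c ⊔ yᶜ \ c ⊔ (x ⊓ c ⊔ y \ c) = (xᶜ ⊓ c ⊔ x ⊓ c) ⊔ (yᶜ \ c ⊔ y \ c) := by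
        ac_rfl
      rw [this, ← inf_sup_right, ← sup_sdiff]
      simp
  have hsup : ∀ x y x' y', F (x, y) ⊔ F (x', y') = F (x ⊔ x', y ⊔ y') := by
    intro x y x' y'
    simp only [F, inf_sup_right, sup_sdiff]
    ac_rfl
  refine ⟨{ graph := F '' (R.graph ×ˢ R.graph)
            countable := (R.countable.prod R.countable).image F
            bot_mem := ⟨(⊥, ⊥), ⟨R.bot_mem, R.bot_mem⟩, by simp [F]; rfl⟩
            compl_mem := ?_
            sup_mem := ?_
            eq_bot := ?_ }, ?_, ?_⟩
  · rintro _ ⟨⟨x, y⟩, ⟨hx, hy⟩, rfl⟩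
    exact ⟨(xᶜ, yᶜ), ⟨R.compl_mem _ hx, R.compl_mem _ hy⟩, (hcompl x y).symm⟩
  · rintro _ ⟨⟨x, y⟩, ⟨hx, hy⟩, rfl⟩ _ ⟨⟨x', y'⟩, ⟨hx', hy'⟩, rfl⟩
    exact ⟨(x ⊔ x', y ⊔ y'), ⟨R.sup_mem _ hx _ hx', R.sup_mem _ hy _ hy'⟩, (hsup _ _ _ _).symm⟩
  · rintro _ ⟨⟨x, y⟩, ⟨hx, hy⟩, rfl⟩ hfin
    change x.2 ⊓ c.2 ⊔ y.2 \ c.2 = ⊥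
    change (x.1 ∩ c.1 ∪ y.1 \ c.1).Finite at hfin
    rw [h₁ x hx (hfin.subset subset_union_left), h₂ y hy (hfin.subset subset_union_right)]
    simp
  · exact fun x hx => ⟨(x, x), ⟨hx, hx⟩, sup_inf_sdiff x c⟩
  · exact ⟨(⊤, ⊥), ⟨R.top_mem, R.bot_mem⟩, by simp [F]⟩

theorem exists_extension_dom (hB : CountablySeparated B) (R : PartialHom B) (a : Set ℕ) :
    ∃ S, R ≤ S ∧ ∃ b, (a, b) ∈ S.graph := by
  obtain ⟨b, hb₁, hb₂⟩ := hB (Prod.snd '' {x ∈ R.graph | (x.1 \ a).Finite})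
    (Prod.snd '' {x ∈ R.graph | (a \ x.1).Finite})
    ((R.countable.mono (sep_subset _ _)).image _) ((R.countable.mono (sep_subset _ _)).image _)
    (by
      rintro _ ⟨x, ⟨hx, hxa⟩, rfl⟩ _ ⟨y, ⟨hy, hya⟩, rfl⟩
      exact R.le_of_finite hx hy (hxa.sdiff_trans hya))
  obtain ⟨S, hRS, hS⟩ := R.exists_extension (a, b)
    (by
      intro x hx hfin
      have := hb₂ (xᶜ).2 ⟨_, ⟨R.compl_mem _ hx, by
        change (a \ (x.1)ᶜ).Finite
        rwa [sdiff_compl, inter_comm]⟩, rfl⟩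
      exact disjoint_iff.1 (le_compl_iff_disjoint_right.1 this).symm)
    (by
      intro x hx hfin
      exact sdiff_eq_bot_iff.2 (hb₁ _ ⟨x, ⟨hx, hfin⟩, rfl⟩))
  exact ⟨S, hRS, b, hS⟩

theorem exists_extension_dom_seq (hB : CountablySeparated B) (R : PartialHom B)
    (a : ℕ → Set ℕ) : ∃ S, R ≤ S ∧ ∀ n, ∃ b, (a n, b) ∈ S.graph := by
  choose E hE hEa using fun (R : PartialHom B) a => exists_extension_dom hB R a
  let f : ℕ → PartialHom B := fun n => Nat.rec R (fun n T => E T (a n)) n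
  have hf : Monotone f := monotone_nat_of_le_succ fun n => hE (f n) (a n)
  obtain ⟨S, hS⟩ := exists_upperBound f hf
  refine ⟨S, hS 0, fun n => ?_⟩
  obtain ⟨b, hb⟩ := hEa (f n) (a n)
  exact ⟨b, hS (n + 1) hb⟩

theorem exists_extension_ran (R : PartialHom B) (b : B) :
    ∃ S, R ≤ S ∧ ∃ a, (a, b) ∈ S.graph := by
  obtain ⟨x, hx⟩ := (R.countable.image Prod.fst).exists_eq_range ⟨_, _, R.bot_mem, rfl⟩
  classical
  obtain ⟨a, ha⟩ := exists_splitting (fun k => if (x k).Infinite then x k else univ)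
    (fun k => by
      split_ifs with h
      · exact h
      · exact infinite_univ)
  have hsplit : ∀ y ∈ R.graph, y.1.Infinite → (y.1 ∩ a).Infinite ∧ (y.1 \ a).Infinite := by
    intro y hy hinf
    have : y.1 ∈ range x := hx ▸ mem_image_of_mem _ hy
    obtain ⟨k, hk⟩ := this
    have := ha k
    rw [hk, if_pos hinf] at this
    exact this
  obtain ⟨S, hRS, hS⟩ := R.exists_extension (a, b)
    (fun y hy hfin => by
      rw [R.eq_bot y hy (by_contra fun h => (hsplit y hy h).1 hfin), bot_inf_eq])
    (fun y hy hfin => by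
      rw [R.eq_bot y hy (by_contra fun h => (hsplit y hy h).2 hfin), bot_sdiff])
  exact ⟨S, hRS, a, hS⟩

theorem exists_extension_kernel (R : PartialHom B) (a : ℕ → Set ℕ)
    (ha : ∀ n, (a n, ⊥) ∈ R.graph) :
    ∃ S, R ≤ S ∧ ∃ c, (c, ⊥) ∈ S.graph ∧ ∀ n, (a n \ c).Finite := by
  let A : ℕ → Set ℕ := fun n => ⋃ i ≤ n, a i
  have hA : ∀ n, (A n, ⊥) ∈ R.graph := by
    intro n
    induction n with
    | zero => simpa [A] using ha 0
    | succ n ih =>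
      have := R.sup_mem _ ih _ (ha (n + 1))
      have e : A (n + 1) = A n ∪ a (n + 1) := biUnion_le_succ a n
      rw [e]
      simpa using this
  have hmono : Monotone A := fun m n hmn => biUnion_subset_biUnion_left fun i hi => le_trans hi hmn
  have hinf : ∀ y ∈ R.graph, y.2 ≠ ⊥ → ∀ n, (y.1 ∩ (A n)ᶜ).Infinite := by
    intro y hy hne n hfin
    have := R.le_of_finite hy (hA n) (by rwa [sdiff_eq])
    exact hne (le_bot_iff.1 this)
  by_cases hne : ∃ y ∈ R.graph, y.2 ≠ ⊥
  · obtain ⟨x, hx⟩ := ((R.countable.mono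
      (sep_subset R.graph fun y => y.2 ≠ ⊥)).image Prod.fst).exists_eq_range
      (by obtain ⟨y, hy⟩ := hne; exact ⟨_, y, hy, rfl⟩)
    obtain ⟨e, he, hex⟩ := exists_pseudoIntersection (fun n => (A n)ᶜ)
      (fun m n hmn => compl_subset_compl.2 (hmono hmn)) x (by
        intro n k
        have : x k ∈ range x := ⟨k, rfl⟩
        rw [← hx] at this
        obtain ⟨y, ⟨hy, hyne⟩, hyk⟩ := this
        rw [← hyk]
        exact hinf y hy hyne n)
    obtain ⟨S, hRS, hS⟩ := R.exists_extension (eᶜ, ⊥) (fun y _ _ => inf_bot_eq _)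
      (fun y hy hfin => by
        by_contra hyb
        rw [sdiff_bot] at hyb
        have : y.1 ∈ range x := hx ▸ mem_image_of_mem Prod.fst (⟨hy, hyb⟩ : y ∈ R.graph ∧ y.2 ≠ ⊥)
        obtain ⟨k, hk⟩ := this
        refine hex k ?_
        rw [hk]
        simpa using hfin)
    refine ⟨S, hRS, eᶜ, hS, fun n => (he n).subset ?_⟩
    rintro m ⟨hm, hme⟩
    exact ⟨not_not.1 hme, fun h => h (mem_biUnion (le_refl n) hm)⟩
  · push Not at hne
    exact ⟨R, le_rfl, Set.univ, by
      have := R.top_mem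
      rwa [show (⊤ : B) = ⊥ from hne _ this] at this, by simp⟩

end PartialHom

/-- Under CH, every countably separated Boolean algebra of size at most `ℵ₁` is the quotient of
the algebra of subsets of `ℕ` by a P-ideal containing the finite sets. -/
theorem exists_quotient_by_PIdeal (hCH : continuum.{0} = ℵ₁) {B : Type} [BooleanAlgebra B]
    (hB : CountablySeparated B) (hcard : #B ≤ ℵ₁) :
    ∃ φ : Set ℕ → B, (∀ a b, φ (a ∪ b) = φ a ⊔ φ b) ∧ (∀ a, φ aᶜ = (φ a)ᶜ) ∧
      Function.Surjective φ ∧ (∀ a : Set ℕ, a.Finite → φ a = ⊥) ∧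
      ∀ a : ℕ → Set ℕ, (∀ n, φ (a n) = ⊥) → ∃ c, φ c = ⊥ ∧ ∀ n, (a n \ c).Finite := by
  obtain ⟨g, hgD, hgc⟩ := exists_chain_meeting PartialHom.exists_upperBound
    (P := PartialHom B) (ι := B ⊕ (ℕ → Set ℕ))
    (by
      rw [mk_sum, lift_id, lift_id, mk_natSeq_set hCH]
      exact (add_le_add hcard le_rfl).trans (add_eq_self (aleph0_le_aleph 1)).le)
    (Sum.elim (fun b => {R | ∃ a, (a, b) ∈ R.graph})
      (fun a => {R | (∀ n, ∃ b, (a n, b) ∈ R.graph) ∧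
        ((∃ n b, b ≠ ⊥ ∧ (a n, b) ∈ R.graph) ∨
          ∃ c, (c, ⊥) ∈ R.graph ∧ ∀ n, (a n \ c).Finite)}))
    (by
      rintro (b | a) R
      · obtain ⟨S, hRS, hS⟩ := R.exists_extension_ran b
        exact ⟨S, hS, hRS⟩
      · obtain ⟨S, hRS, hS⟩ := R.exists_extension_dom_seq hB a
        by_cases h : ∃ n b, b ≠ ⊥ ∧ (a n, b) ∈ S.graph
        · exact ⟨S, ⟨hS, .inl h⟩, hRS⟩
        · push Not at h
          obtain ⟨T, hST, hT⟩ := S.exists_extension_kernel a (fun n => by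
            obtain ⟨b, hb⟩ := hS n
            by_cases hbb : b = ⊥
            · rwa [hbb] at hb
            · exact (h n b hbb hb).elim)
          exact ⟨T, ⟨fun n => (hS n).imp fun b hb => hST hb, .inr hT⟩, le_trans hRS hST⟩)
  have hdom : ∀ a, ∃ b i, (a, b) ∈ (g i).graph := fun a => by
    obtain ⟨b, hb⟩ := (hgD (.inr fun _ => a)).1 0
    exact ⟨b, _, hb⟩
  choose φ i hφ using hdom
  have common : ∀ i j, ∃ k, g i ≤ g k ∧ g j ≤ g k := fun i j => by
    rcases hgc i j with h | h
    · exact ⟨j, h, le_rfl⟩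
    · exact ⟨i, le_rfl, h⟩
  have huniq : ∀ {a b j}, (a, b) ∈ (g j).graph → φ a = b := by
    intro a b j h
    obtain ⟨k, h₁, h₂⟩ := common (i a) j
    exact (g k).ext_of_fst (h₁ (hφ a)) (h₂ h)
  refine ⟨φ, fun a b => ?_, fun a => ?_, fun b => ?_, fun a ha => ?_, fun a ha => ?_⟩
  · obtain ⟨k, h₁, h₂⟩ := common (i a) (i b)
    exact huniq ((g k).sup_mem _ (h₁ (hφ a)) _ (h₂ (hφ b)))
  · exact huniq ((g _).compl_mem _ (hφ a))
  · obtain ⟨a, ha⟩ := hgD (.inl b)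
    exact ⟨a, huniq ha⟩
  · exact (g _).eq_bot _ (hφ a) ha
  · rcases (hgD (.inr a)).2 with ⟨n, b, hb, hn⟩ | ⟨c, hc, hfin⟩
    · exact (hb ((huniq hn).symm.trans (ha n))).elim
    · exact ⟨c, huniq hc, hfin⟩

/-- The set of finite sequences of natural numbers, in which a set is open if with each `s` it
contains `p s`-almost all immediate successors of `s`. The successors of `s` are the lists
`n :: s`. -/
def SeqSpace (_ : List ℕ → Ultrafilter ℕ) : Type := List ℕ

namespace SeqSpace

variable {p : List ℕ → Ultrafilter ℕ}

/-- The immediate successor of `s` with index `n`. -/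
def child (s : SeqSpace p) (n : ℕ) : SeqSpace p := List.cons n s

/-- The set of all sequences extending `s`. -/
def cone (s : SeqSpace p) : Set (SeqSpace p) := {t : List ℕ | List.IsSuffix s t}

/-- The number of terms of a sequence. -/
def length (s : SeqSpace p) : ℕ := List.length s

instance : Countable (SeqSpace p) := inferInstanceAs (Countable (List ℕ))

instance : TopologicalSpace (SeqSpace p) where
  IsOpen U := ∀ s ∈ U, ∀ᶠ n in (p s : Filter ℕ), child s n ∈ U
  isOpen_univ s _ := by simp
  isOpen_inter U V hU hV s hs := (hU s hs.1).and (hV s hs.2)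
  isOpen_sUnion S hS s := by
    rintro ⟨U, hU, hs⟩
    exact (hS U hU s hs).mono fun n hn => ⟨U, hU, hn⟩

theorem isOpen_iff {U : Set (SeqSpace p)} :
    IsOpen U ↔ ∀ s ∈ U, ∀ᶠ n in (p s : Filter ℕ), child s n ∈ U := Iff.rfl

theorem child_injective (s : SeqSpace p) : Function.Injective (child s) := fun _ _ h =>
  (List.cons.inj h).1

theorem length_child (s : SeqSpace p) (n : ℕ) : (child s n).length = s.length + 1 :=
  List.length_cons

theorem child_ne (s : SeqSpace p) (n : ℕ) : child s n ≠ s := List.cons_ne_self n s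

theorem self_mem_cone (s : SeqSpace p) : s ∈ cone s := List.suffix_rfl

theorem cone_subset {s t : SeqSpace p} (h : t ∈ cone s) : cone t ⊆ cone s := fun _ ht =>
  List.IsSuffix.trans h ht

theorem child_mem_cone (s : SeqSpace p) (n : ℕ) : child s n ∈ cone s := List.suffix_cons n s

theorem length_le {s t : SeqSpace p} (h : t ∈ cone s) : s.length ≤ t.length :=
  List.IsSuffix.length_le h

theorem eq_of_mem_cone {s t : SeqSpace p} (h : t ∈ cone s) (h' : s ∈ cone t) : s = t :=
  List.IsSuffix.eq_of_length h (le_antisymm (length_le h) (length_le h'))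

theorem child_mem_cone_iff {s t : SeqSpace p} {n : ℕ} :
    child t n ∈ cone s ↔ s = child t n ∨ t ∈ cone s :=
  List.suffix_cons_iff

theorem mem_cone_iff {s t : SeqSpace p} : t ∈ cone s ↔ t = s ∨ ∃ n, t ∈ cone (child s n) := by
  constructor
  · rintro ⟨l, rfl⟩
    rcases List.eq_nil_or_concat l with rfl | ⟨l, n, rfl⟩
    · exact .inl rfl
    · exact .inr ⟨n, l, (List.concat_append ..).symm⟩
  · rintro (rfl | ⟨n, hn⟩)
    · exact self_mem_cone _
    · exact cone_subset (child_mem_cone s n) hn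

theorem eq_of_mem_cone_child {s t : SeqSpace p} {m n : ℕ} (hm : t ∈ cone (child s m))
    (hn : t ∈ cone (child s n)) : m = n := by
  have hle : (child s m).length = (child s n).length := by simp only [length_child]
  have : child s m = child s n :=
    List.IsSuffix.eq_of_length (List.suffix_of_suffix_length_le hm hn hle.le) hle
  exact child_injective s this

theorem finite_ancestors (t : SeqSpace p) :
    {q : SeqSpace p × ℕ | t ∈ cone (child q.1 q.2)}.Finite := by
  have h : {r : SeqSpace p | t ∈ cone r}.Finite :=
    (List.finite_toSet (List.tails t)).subset fun r hr => (List.mem_tails _ _).2 hr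
  refine h.preimage (f := fun q : SeqSpace p × ℕ => child q.1 q.2) fun a _ b _ hab => ?_
  have := List.cons.inj hab
  exact Prod.ext this.2 this.1

theorem isClopen_cone (hp : ∀ s, IsPPoint (p s)) (s : SeqSpace p) : IsClopen (cone s) := by
  refine ⟨⟨isOpen_iff.2 fun t ht => ?_⟩, isOpen_iff.2 fun t ht =>
    .of_forall fun n => cone_subset ht (child_mem_cone t n)⟩
  have hfin : {n | s = child t n}.Finite := by
    refine Set.Subsingleton.finite fun m hm n hn => child_injective t ?_
    exact Eq.trans (Eq.symm hm) hn
  refine mem_of_superset (Ultrafilter.compl_mem_iff_notMem.2 ((hp t).1 _ hfin)) fun n hn => ?_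
  rintro h
  rcases child_mem_cone_iff.1 h with h | h
  · exact hn h
  · exact ht h

theorem isClopen_fan (hp : ∀ s, IsPPoint (p s)) (s : SeqSpace p) {A : Set ℕ} (hA : A ∈ p s) :
    IsClopen ({s} ∪ ⋃ n ∈ A, cone (child s n)) := by
  have hunion : ∀ A : Set ℕ, IsOpen (⋃ n ∈ A, cone (child s n)) := fun A =>
    isOpen_biUnion fun n _ => (isClopen_cone hp _).isOpen
  constructor
  · have : ({s} ∪ ⋃ n ∈ A, cone (child s n))ᶜ = (cone s)ᶜ ∪ ⋃ n ∈ Aᶜ, cone (child s n) := by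
      ext t
      simp only [mem_compl_iff, mem_union, mem_singleton_iff, mem_iUnion, exists_prop, not_or,
        not_exists, not_and]
      constructor
      · rintro ⟨h₁, h₂⟩
        by_cases ht : t ∈ cone s
        · rcases mem_cone_iff.1 ht with h | ⟨n, hn⟩
          · exact (h₁ h).elim
          · exact .inr ⟨n, fun hnA => h₂ n hnA hn, hn⟩
        · exact .inl ht
      · rintro (h | ⟨n, hnA, hn⟩)
        · exact ⟨fun hts => h (hts ▸ self_mem_cone t),
            fun n _ hn => h (mem_cone_iff.2 (.inr ⟨n, hn⟩))⟩
        · refine ⟨?_, fun m hm hm' => hnA (eq_of_mem_cone_child hm' hn ▸ hm)⟩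
          rintro rfl
          have := length_le hn
          rw [length_child] at this
          lia
    rw [← isOpen_compl_iff, this]
    exact (isClopen_cone hp s).compl.isOpen.union (hunion _)
  · refine isOpen_iff.2 ?_
    rintro t (ht | ht)
    · obtain rfl : t = s := ht
      filter_upwards [hA] with n hn
      exact .inr (mem_biUnion hn (self_mem_cone _))
    · exact (isOpen_iff.1 (hunion A) t ht).mono fun n hn => .inr hn

theorem isOpen_closure {U : Set (SeqSpace p)} (hU : IsOpen U) : IsOpen (closure U) := by
  refine isOpen_iff.2 fun s hs => ?_
  by_cases hsU : s ∈ U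
  · exact (isOpen_iff.1 hU s hsU).mono fun n hn => subset_closure hn
  · by_contra hcon
    have hev : ∀ᶠ n in (p s : Filter ℕ), child s n ∈ (closure U)ᶜ :=
      Ultrafilter.eventually_not.2 hcon
    have hopen : IsOpen ({s} ∪ (closure U)ᶜ) := by
      refine isOpen_iff.2 ?_
      rintro t (ht | ht)
      · obtain rfl : t = s := ht
        exact hev.mono fun n hn => .inr hn
      · exact (isOpen_iff.1 isClosed_closure.isOpen_compl t ht).mono fun n hn => .inr hn
    obtain ⟨t, ht | ht, htU⟩ := mem_closure_iff.1 hs _ hopen (.inl rfl)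
    · obtain rfl : t = s := ht
      exact hsU htU
    · exact ht (subset_closure htU)

theorem countablySeparated_clopens : CountablySeparated (TopologicalSpace.Clopens (SeqSpace p)) := by
  intro S T _ _ hST
  have hopen : IsOpen (⋃ s ∈ S, (s : Set (SeqSpace p))) :=
    isOpen_biUnion fun s _ => s.isClopen.isOpen
  refine ⟨⟨closure (⋃ s ∈ S, (s : Set (SeqSpace p))), isClosed_closure, isOpen_closure hopen⟩,
    fun s hs x hx => subset_closure (mem_biUnion hs hx), fun t ht => ?_⟩
  exact closure_minimal (iUnion₂_subset fun s hs => hST s hs t ht) t.isClopen.isClosed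

theorem mk_clopens_le : #(TopologicalSpace.Clopens (SeqSpace p)) ≤ continuum := by
  refine (mk_le_of_injective (f := fun C : TopologicalSpace.Clopens (SeqSpace p) =>
    (C : Set (SeqSpace p))) SetLike.coe_injective).trans ?_
  rw [mk_set, ← two_power_aleph0]
  exact power_le_power_left two_ne_zero (mk_le_aleph0)

end SeqSpace

open SeqSpace

/-- `e` is a dense continuous injection of `SeqSpace p` into `K` such that every clopen subset of
`SeqSpace p` is the trace of a clopen subset of `K`. -/
structure IsCompactification {p : List ℕ → Ultrafilter ℕ} {K : Type*} [TopologicalSpace K]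
    (e : SeqSpace p → K) : Prop where
  continuous : Continuous e
  injective : Function.Injective e
  denseRange : DenseRange e
  exists_preimage_eq : ∀ C, IsClopen C → ∃ D, IsClopen D ∧ e ⁻¹' D = C

namespace IsCompactification

variable {p q : List ℕ → Ultrafilter ℕ} {K L : Type*} [TopologicalSpace K] [TopologicalSpace L]
  {e : SeqSpace p → K} {f : SeqSpace q → L}

theorem subset_of_preimage_subset (he : IsCompactification e) {C D : Set K} (hC : IsClopen C)
    (hD : IsClopen D) (h : e ⁻¹' C ⊆ e ⁻¹' D) : C ⊆ D := by
  by_contra hcon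
  obtain ⟨x, hxC, hxD⟩ := not_subset.1 hcon
  obtain ⟨s, hs⟩ := he.denseRange.exists_mem_open (hC.isOpen.inter hD.compl.isOpen)
    ⟨x, hxC, hxD⟩
  exact hs.2 (h hs.1)

/-- No point of `SeqSpace p` is in the closure of a countable subset of the remainder. -/
theorem exists_isClopen_disjoint [TotallySeparatedSpace K] (hp : ∀ s, IsPPoint (p s))
    (he : IsCompactification e) {Y : Set K} (hY : Y.Countable) (hYe : Disjoint Y (range e))
    (s : SeqSpace p) : ∃ C, IsClopen C ∧ e s ∈ C ∧ Disjoint C Y := by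
  rcases Y.eq_empty_or_nonempty with rfl | hne
  · exact ⟨Set.univ, isClopen_univ, mem_univ _, disjoint_empty _⟩
  obtain ⟨y, rfl⟩ := hY.exists_eq_range hne
  have hW : ∀ k r, ∃ W, IsClopen W ∧ e r ∈ W ∧ y k ∉ W := fun k r => by
    obtain ⟨W, hW, hrW, hyW⟩ := exists_isClopen_of_totally_separated
      (i := e r) (j := y k) fun h => disjoint_left.1 hYe ⟨k, rfl⟩ ⟨r, h⟩
    exact ⟨W, hW, hrW, hyW⟩
  choose W hWc hrW hyW using hW
  choose Z hZc hZ using fun r : SeqSpace p => he.exists_preimage_eq _ (isClopen_cone hp r)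
  have hA : ∀ r, ∃ A ∈ p r, ∀ k, (A \ {n | e (child r n) ∈ W k r}).Finite := fun r =>
    (hp r).2 _ fun k =>
      isOpen_iff.1 ((hWc k r).isOpen.preimage he.continuous) r (hrW k r)
  choose A hAp hAW using hA
  have hZsub : ∀ {C D : SeqSpace p}, cone C ⊆ cone D → Z C ⊆ Z D := fun {C D} h =>
    he.subset_of_preimage_subset (hZc C) (hZc D) (by rwa [hZ, hZ])
  let E : SeqSpace p → Set ℕ := fun r => {n | ∃ k ≤ r.length, y k ∈ Z (child r n)}
  have hE : ∀ r, (E r).Finite := by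
    intro r
    have : E r = ⋃ k ∈ {k | k ≤ r.length}, {n | y k ∈ Z (child r n)} := by
      ext n; simp [E]
    rw [this]
    refine (finite_le_nat _).biUnion fun k _ => Set.Subsingleton.finite fun m hm n hn => ?_
    by_contra hmn
    have hsub : Z (child r m) ⊆ (Z (child r n))ᶜ := by
      refine he.subset_of_preimage_subset (hZc _) (hZc _).compl ?_
      rw [preimage_compl, hZ, hZ]
      exact fun t ht ht' => hmn (eq_of_mem_cone_child ht ht')
    exact hsub hm hn
  let V : Set (SeqSpace p) := {t | t ∈ cone s ∧ ∀ r n, r ∈ cone s → t ∈ cone (child r n) →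
    n ∈ A r ∧ n ∉ E r ∧ ∀ k ≤ n, e (child r n) ∈ W k r → e t ∈ W k r}
  have hsV : s ∈ V := by
    refine ⟨self_mem_cone s, fun r n hr hs => ?_⟩
    have h₁ := length_le hr
    have h₂ := length_le hs
    rw [length_child] at h₂
    lia
  have hVo : IsOpen V := by
    refine isOpen_iff.2 fun t ht => ?_
    have hold : ∀ᶠ n in (p t : Filter ℕ), ∀ x ∈ {x : SeqSpace p × ℕ | t ∈ cone (child x.1 x.2)},
        ∀ k ∈ {k | k ≤ x.2}, e t ∈ W k x.1 → e (child t n) ∈ W k x.1 := by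
      refine (eventually_all_finite (finite_ancestors t)).2 fun x _ =>
        (eventually_all_finite (finite_le_nat _)).2 fun k _ => ?_
      by_cases h : e t ∈ W k x.1
      · exact (isOpen_iff.1 ((hWc k x.1).isOpen.preimage he.continuous) t h).mono
          fun n hn _ => hn
      · exact .of_forall fun n h' => (h h').elim
    filter_upwards [hold, hAp t, Ultrafilter.compl_mem_iff_notMem.2 ((hp t).1 _ (hE t))]
      with n hn hnA hnE
    refine ⟨cone_subset ht.1 (child_mem_cone t n), fun r m hr hrm => ?_⟩
    rcases child_mem_cone_iff.1 hrm with h | h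
    · have := List.cons.inj h
      obtain ⟨rfl, rfl⟩ : m = n ∧ r = t := this
      exact ⟨hnA, hnE, fun k _ hk => hk⟩
    · obtain ⟨h₁, h₂, h₃⟩ := ht.2 r m hr h
      exact ⟨h₁, h₂, fun k hk hkW => hn (r, m) h k hk (h₃ k hk hkW)⟩
  obtain ⟨C, hC, hCV⟩ := he.exists_preimage_eq (closure V)
    ⟨isClosed_closure, SeqSpace.isOpen_closure hVo⟩
  refine ⟨C, hC, ?_, ?_⟩
  · have : s ∈ e ⁻¹' C := hCV ▸ subset_closure hsV
    exact this
  suffices hD : ∀ k, ∃ D, IsClopen D ∧ y k ∉ D ∧ V ⊆ e ⁻¹' D by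
    refine disjoint_right.2 ?_
    rintro _ ⟨k, rfl⟩ hk
    obtain ⟨D, hD, hyD, hVD⟩ := hD k
    refine hyD (he.subset_of_preimage_subset hC hD ?_ hk)
    rw [hCV]
    exact closure_minimal hVD (hD.isClosed.preimage he.continuous)
  intro k
  by_cases hbranch : ∃ r n, r ∈ cone s ∧ k ≤ r.length ∧ y k ∈ Z (child r n)
  · obtain ⟨r, n, hr, hk, hy⟩ := hbranch
    refine ⟨(Z (child r n))ᶜ, (hZc _).compl, fun h => h hy, fun t ht => ?_⟩
    rw [preimage_compl, hZ]
    exact fun htn => (ht.2 r n hr htn).2.1 ⟨k, hk, hy⟩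
  by_cases hroot : y k ∈ Z s
  swap
  · exact ⟨Z s, hZc s, hroot, fun t ht => by rw [hZ]; exact ht.1⟩
  by_cases hend : ∃ r ∈ cone s, y k ∈ Z r ∧ ∀ n, y k ∉ Z (child r n)
  · obtain ⟨r, hr, hyr, hyn⟩ := hend
    have hfin : ({n | n < k} ∪ (A r \ {n | e (child r n) ∈ W k r})).Finite :=
      (finite_lt_nat k).union (hAW r k)
    refine ⟨W k r ∪ (Z r)ᶜ ∪ ⋃ n ∈ ({n | n < k} ∪ (A r \ {n | e (child r n) ∈ W k r})),
      Z (child r n), ((hWc k r).union (hZc r).compl).union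
        (hfin.isClopen_biUnion fun n _ => hZc _), ?_, fun t ht => ?_⟩
    · rintro ((h | h) | h)
      · exact hyW k r h
      · exact h hyr
      · obtain ⟨n, _, hn⟩ := mem_iUnion₂.1 h
        exact hyn n hn
    · by_cases htr : t ∈ cone r
      swap
      · refine .inl (.inr ?_)
        rw [← hZ] at htr
        exact htr
      rcases mem_cone_iff.1 htr with rfl | ⟨n, hn⟩
      · exact .inl (.inl (hrW k _))
      · obtain ⟨hnA, _, hnW⟩ := ht.2 r n hr hn
        by_cases hnF : n ∈ ({n | n < k} ∪ (A r \ {n | e (child r n) ∈ W k r}))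
        · refine .inr (mem_biUnion hnF ?_)
          rw [← hZ] at hn
          exact hn
        · rw [mem_union, not_or] at hnF
          exact .inl (.inl (hnW k (not_lt.1 hnF.1)
            (by_contra fun h => hnF.2 ⟨hnA, h⟩)))
  · exfalso
    push Not at hend
    have hlong : ∀ m, ∃ r ∈ cone s, y k ∈ Z r ∧ m ≤ r.length := by
      intro m
      induction m with
      | zero => exact ⟨s, self_mem_cone s, hroot, Nat.zero_le _⟩
      | succ m ih =>
        obtain ⟨r, hr, hy, hm⟩ := ih
        obtain ⟨n, hn⟩ := hend r hr hy
        exact ⟨child r n, cone_subset hr (child_mem_cone r n), hn, by rw [length_child]; lia⟩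
    obtain ⟨r, hr, hy, hk⟩ := hlong k
    obtain ⟨n, hn⟩ := hend r hr hy
    exact hbranch ⟨r, n, hr, hk, hn⟩

/-- If a homeomorphism maps `s` to `t`, then the ultrafilter at `t` is Rudin–Keisler below the
ultrafilter at `s`. -/
theorem exists_map_eq [TotallySeparatedSpace L] (hq : ∀ s, IsPPoint (q s))
    (he : IsCompactification e) (hf : IsCompactification f) (h : K ≃ₜ L) {s : SeqSpace p}
    {t : SeqSpace q} (hst : h (e s) = f t) : ∃ g : ℕ → ℕ, (p s).map g = q t := by
  classical
  have hnhds : ∀ C : Set L, IsOpen C → f t ∈ C →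
      ∀ᶠ n in (p s : Filter ℕ), h (e (child s n)) ∈ C := fun C hC htC =>
    isOpen_iff.1 (hC.preimage (h.continuous.comp he.continuous)) s
      (by rw [mem_preimage, Function.comp_apply, hst]; exact htC)
  have hN : ∀ᶠ n in (p s : Filter ℕ), h (e (child s n)) ∈ range f := by
    by_contra hcon
    have hcon' := Ultrafilter.eventually_not.2 hcon
    obtain ⟨C, hC, htC, hdisj⟩ := hf.exists_isClopen_disjoint hq
      (Y := (fun n => h (e (child s n))) '' {n | h (e (child s n)) ∉ range f})
      ((to_countable _).image _)
      (by
        refine disjoint_left.2 ?_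
        rintro _ ⟨n, hn, rfl⟩
        exact hn) t
    obtain ⟨n, hn, hnC⟩ := (hcon'.and (hnhds C hC.isOpen htC)).exists
    exact disjoint_left.1 hdisj hnC ⟨n, hn, rfl⟩
  let g : ℕ → ℕ := fun n =>
    if H : ∃ m, ∃ t' ∈ cone (child t m), f t' = h (e (child s n)) then H.choose else 0
  refine ⟨g, Ultrafilter.coe_le_coe.1 fun A hA => ?_⟩
  obtain ⟨D, hD, hDf⟩ := hf.exists_preimage_eq _ (isClopen_fan hq t hA)
  have htD : t ∈ f ⁻¹' D := hDf ▸ .inl rfl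
  change ∀ᶠ n in (p s : Filter ℕ), g n ∈ A
  filter_upwards [hN, hnhds D hD.isOpen htD] with n hn hnD
  obtain ⟨t', ht'⟩ := hn
  have htf : t' ∈ f ⁻¹' D := by rw [mem_preimage, ht']; exact hnD
  rw [hDf] at htf
  rcases htf with htf | htf
  · obtain rfl : t' = t := htf
    exact (child_ne s n (he.injective (h.injective (ht'.symm.trans hst.symm)))).elim
  · obtain ⟨m, hmA, hm⟩ := mem_iUnion₂.1 htf
    have H : ∃ m, ∃ t' ∈ cone (child t m), f t' = h (e (child s n)) := ⟨m, t', hm, ht'⟩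
    have hg : g n = H.choose := dif_pos H
    obtain ⟨t'', h₁, h₂⟩ := H.choose_spec
    obtain rfl : t'' = t' := hf.injective (h₂.trans ht'.symm)
    rw [hg, eq_of_mem_cone_child h₁ hm]
    exact hmA

/-- A homeomorphism maps densely many points of `SeqSpace p` to points of `SeqSpace q`. -/
theorem exists_mem_map_eq [TotallySeparatedSpace L] (hq : ∀ s, IsPPoint (q s))
    (he : IsCompactification e) (hf : IsCompactification f) (h : K ≃ₜ L) {O : Set K}
    (hO : IsOpen O) (hne : O.Nonempty) : ∃ s t, e s ∈ O ∧ h (e s) = f t := by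
  by_contra hcon
  push Not at hcon
  obtain ⟨t, ht⟩ := hf.denseRange.exists_mem_open (h.isOpen_image.2 hO) (hne.image h)
  obtain ⟨C, hC, htC, hdisj⟩ := hf.exists_isClopen_disjoint hq
    (Y := (fun s => h (e s)) '' (e ⁻¹' O)) ((to_countable _).image _)
    (by
      refine disjoint_left.2 ?_
      rintro _ ⟨s, hs, rfl⟩ ⟨t, ht⟩
      exact hcon s t hs ht.symm) t
  obtain ⟨x, hxO, hx⟩ := ht
  obtain ⟨s, hs⟩ := he.denseRange.exists_mem_open (hO.inter (hC.isOpen.preimage h.continuous))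
    ⟨x, hxO, by rw [mem_preimage, hx]; exact htC⟩
  exact disjoint_left.1 hdisj hs.2 ⟨s, hs.1, rfl⟩

end IsCompactification

theorem isClopen_setOf_mem_NStar (a : Set ℕ) : IsClopen {u : NStar | a ∈ u.1} :=
  ⟨(ultrafilter_isClosed_basic a).preimage continuous_subtype_val,
    (ultrafilter_isOpen_basic a).preimage continuous_subtype_val⟩

theorem NStar.notMem_of_finite (u : NStar) {a : Set ℕ} (ha : a.Finite) : a ∉ u.1 := by
  intro h
  obtain ⟨n, _, hn⟩ := Ultrafilter.eq_pure_of_finite_mem ha h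
  exact u.2 n hn

instance : CompactSpace NStar := by
  have h : IsClosed {u : Ultrafilter ℕ | ∀ n : ℕ, u ≠ pure n} := by
    have : {u : Ultrafilter ℕ | ∀ n : ℕ, u ≠ pure n} = ⋂ n : ℕ, {u | ({n}ᶜ : Set ℕ) ∈ u} := by
      ext u
      simp only [mem_ofPred_eq, mem_iInter, Ultrafilter.compl_mem_iff_notMem]
      refine forall_congr' fun n => not_congr ⟨fun h => h ▸ mem_pure.2 rfl, fun h => ?_⟩
      obtain ⟨m, hm, hu⟩ := Ultrafilter.eq_pure_of_finite_mem (finite_singleton n) h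
      rw [hu, mem_singleton_iff.1 hm]
    rw [this]
    exact isClosed_iInter fun n => ultrafilter_isClosed_basic _
  exact isCompact_iff_compactSpace.1 h.isCompact

theorem NStar.exists_mem_subset {U : Set NStar} (hU : IsOpen U) {u : NStar} (hu : u ∈ U) :
    ∃ a ∈ u.1, {v : NStar | a ∈ v.1} ⊆ U := by
  obtain ⟨V, hV, rfl⟩ := isOpen_induced_iff.1 hU
  obtain ⟨_, ⟨a, rfl⟩, hua, haV⟩ := ultrafilterBasis_is_basis.exists_subset_of_mem_open hu hV
  exact ⟨a, hua, fun v hv => haV hv⟩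

/-- The closed subset of `ℕ*` given by the ideal of zeros of `φ`. -/
def zeroSet {B : Type*} [Bot B] (φ : Set ℕ → B) : Set NStar := {u | ∀ a, φ a = ⊥ → a ∉ u.1}

theorem isClosed_zeroSet {B : Type*} [Bot B] (φ : Set ℕ → B) : IsClosed (zeroSet φ) := by
  have : zeroSet φ = ⋂ a ∈ {a | φ a = ⊥}, {u : NStar | a ∈ u.1}ᶜ := by
    ext u; simp [zeroSet]
  rw [this]
  exact isClosed_biInter fun a _ => (isClopen_setOf_mem_NStar a).compl.isClosed

section Quotient

variable {B : Type} [BooleanAlgebra B] {φ : Set ℕ → B}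

theorem map_mono_of_sup (hsup : ∀ a b, φ (a ∪ b) = φ a ⊔ φ b) {a b : Set ℕ} (h : a ⊆ b) :
    φ a ≤ φ b := by
  rw [← union_eq_self_of_subset_left h, hsup]
  exact le_sup_left

theorem map_inter_of_sup (hsup : ∀ a b, φ (a ∪ b) = φ a ⊔ φ b) (hcompl : ∀ a, φ aᶜ = (φ a)ᶜ)
    (a b : Set ℕ) : φ (a ∩ b) = φ a ⊓ φ b := by
  rw [← compl_compl (a ∩ b), compl_inter, hcompl, hsup, hcompl, hcompl, compl_sup, compl_compl,
    compl_compl]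

theorem isPSet_zeroSet (hsup : ∀ a b, φ (a ∪ b) = φ a ⊔ φ b)
    (hfin : ∀ a : Set ℕ, a.Finite → φ a = ⊥)
    (hP : ∀ a : ℕ → Set ℕ, (∀ n, φ (a n) = ⊥) → ∃ c, φ c = ⊥ ∧ ∀ n, (a n \ c).Finite) :
    IsPSet (zeroSet φ) := by
  refine ⟨isClosed_zeroSet φ, fun U hU => ?_⟩
  have key : ∀ n, ∃ a, φ a = ⊥ ∧ {u : NStar | a ∉ u.1} ⊆ U n := by
    intro n
    have hdir : Directed (· ⊇ ·) fun a : {a // φ a = ⊥} => {u : NStar | a.1 ∉ u.1} := by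
      rintro ⟨a, ha⟩ ⟨b, hb⟩
      refine ⟨⟨a ∪ b, by rw [hsup, ha, hb, sup_bot_eq]⟩, fun u hu h => hu ?_, fun u hu h => hu ?_⟩
      · exact mem_of_superset h subset_union_left
      · exact mem_of_superset h subset_union_right
    have : Nonempty {a // φ a = ⊥} := ⟨⟨∅, hfin ∅ finite_empty⟩⟩
    obtain ⟨⟨a, ha⟩, haU⟩ := exists_subset_nhds_of_compactSpace hdir
      (fun a => (isClopen_setOf_mem_NStar a.1).compl.isClosed) (U := U n) (fun u hu =>
        (hU n).1.mem_nhds ((hU n).2 fun a ha => mem_iInter.1 hu ⟨a, ha⟩))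
    exact ⟨a, ha, haU⟩
  choose a ha haU using key
  obtain ⟨c, hc, hac⟩ := hP a ha
  refine fun u hu => mem_interior.2 ⟨{u : NStar | c ∉ u.1}, fun v hv => mem_iInter.2 fun n => ?_,
    (isClopen_setOf_mem_NStar c).compl.isOpen, hu c hc⟩
  refine haU n fun han => ?_
  refine v.notMem_of_finite (hac n) ?_
  exact inter_mem han (Ultrafilter.compl_mem_iff_notMem.2 hv)

end Quotient

/-- Under CH, `SeqSpace p` has a compactification that is a P-set of `ℕ*`. -/
theorem exists_isPSet_isCompactification (hCH : continuum.{0} = ℵ₁) {p : List ℕ → Ultrafilter ℕ}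
    (hp : ∀ s, IsPPoint (p s)) :
    ∃ (K : Set NStar) (e : SeqSpace p → K), IsPSet K ∧ IsCompactification e := by
  obtain ⟨φ, hsup, hcompl, hsurj, hfin, hP⟩ := exists_quotient_by_PIdeal hCH
    (SeqSpace.countablySeparated_clopens (p := p)) (hCH ▸ SeqSpace.mk_clopens_le)
  let F : SeqSpace p → Filter ℕ := fun x =>
    { sets := {a | x ∈ φ a}
      univ_sets := by
        have : φ Set.univ = ⊤ := by rw [← compl_empty, hcompl, hfin ∅ finite_empty, compl_bot]
        change x ∈ φ Set.univ
        rw [this]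
        exact mem_univ x
      sets_of_superset := fun ha hab => map_mono_of_sup hsup hab ha
      inter_sets := fun {a b} ha hb => by
        change x ∈ φ (a ∩ b)
        rw [map_inter_of_sup hsup hcompl]
        exact ⟨ha, hb⟩ }
  let u : SeqSpace p → Ultrafilter ℕ := fun x => Ultrafilter.ofComplNotMemIff (F x) fun a => by
    change ¬ (x ∈ φ aᶜ) ↔ x ∈ φ a
    rw [hcompl]
    exact not_not
  have hu : ∀ x a, a ∈ u x ↔ x ∈ φ a := fun x a => Iff.rfl
  have hbot : ∀ x a, φ a = ⊥ → a ∉ u x := fun x a ha h => by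
    rw [hu, ha] at h
    exact h
  let e : SeqSpace p → zeroSet φ := fun x =>
    ⟨⟨u x, fun n hn => hbot x {n} (hfin _ (finite_singleton n)) (hn ▸ mem_pure.2 rfl)⟩, hbot x⟩
  refine ⟨zeroSet φ, e, isPSet_zeroSet hsup hfin hP, ?_, ?_, ?_, ?_⟩
  · refine Continuous.subtype_mk (Continuous.subtype_mk ?_ _) _
    refine ultrafilterBasis_is_basis.continuous_iff.2 ?_
    rintro _ ⟨a, rfl⟩
    exact (φ a).isClopen.isOpen
  · intro x y hxy
    have hmem : ∀ C : Set (SeqSpace p), IsClopen C → (x ∈ C ↔ y ∈ C) := by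
      intro C hC
      obtain ⟨a, ha⟩ := hsurj ⟨C, hC⟩
      have h : u x = u y := congrArg (fun v : zeroSet φ => v.1.1) hxy
      have := hu x a
      rw [h, hu, ha] at this
      exact this.symm
    exact eq_of_mem_cone ((hmem _ (isClopen_cone hp x)).1 (self_mem_cone x))
      ((hmem _ (isClopen_cone hp y)).2 (self_mem_cone y))
  · refine dense_iff_inter_open.2 fun U hU => ?_
    rintro ⟨v, hv⟩
    obtain ⟨U', hU', rfl⟩ := isOpen_induced_iff.1 hU
    obtain ⟨a, hav, haU⟩ := NStar.exists_mem_subset hU' hv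
    have hne : φ a ≠ ⊥ := fun h => v.2 a h hav
    obtain ⟨x, hx⟩ : (φ a : Set (SeqSpace p)).Nonempty := by
      rw [nonempty_iff_ne_empty]
      exact fun h => hne (SetLike.coe_injective h)
    exact ⟨e x, haU hx, x, rfl⟩
  · intro C hC
    obtain ⟨a, ha⟩ := hsurj ⟨C, hC⟩
    refine ⟨_, (isClopen_setOf_mem_NStar a).preimage continuous_subtype_val, ?_⟩
    ext x
    change x ∈ φ a ↔ x ∈ C
    rw [ha]
    rfl

/-- Assuming CH, there are continuum many pairwise non-homeomorphic nonempty separable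
rigid P-sets in `ℕ*`. -/
theorem rigid_P_sets_of_CH (hCH : Cardinal.continuum = Cardinal.aleph 1) :
    ∃ (I : Type) (K : I → Set NStar),
      Cardinal.mk I = Cardinal.continuum ∧
      (∀ i, (K i).Nonempty) ∧
      (∀ i, IsPSet (K i)) ∧
      (∀ i, TopologicalSpace.SeparableSpace (K i)) ∧
      (∀ i, ∀ φ : (K i) ≃ₜ (K i), φ = Homeomorph.refl (K i)) ∧
      ∀ i j, i ≠ j → IsEmpty ((K i) ≃ₜ (K j)) := by
  replace hCH : continuum.{0} = ℵ₁ :=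
    lift_injective (lift_continuum.trans (hCH.trans (by simp)))
  obtain ⟨u, hu, hne⟩ := exists_isPPoint_family hCH (J := ℝ × List ℕ) (by
    rw [mk_prod, lift_id, lift_id, mk_real, hCH]
    exact (mul_le_mul' le_rfl (mk_le_aleph0.trans (aleph0_le_aleph 1))).trans
      (mul_eq_self (aleph0_le_aleph 1)).le)
  choose K e hK he using fun i : ℝ => exists_isPSet_isCompactification hCH
    (p := fun s => u (i, s)) fun s => hu (i, s)
  have hcomp : ∀ i, CompactSpace (K i) := fun i =>
    isCompact_iff_compactSpace.1 (hK i).1.isCompact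
  have key : ∀ i j (h : K i ≃ₜ K j) s t, h (e i s) = e j t → (i, s) = (j, t) :=
    fun i j h s t hst => hne (i, s) (j, t)
      ((he i).exists_map_eq (fun s => hu (j, s)) (he j) h hst)
      ((he j).exists_map_eq (fun s => hu (i, s)) (he i) h.symm
        (h.symm_apply_eq.2 hst.symm))
  refine ⟨ℝ, K, mk_real, fun i => ⟨_, (e i []).2⟩, hK, fun i => ?_, fun i h => ?_,
    fun i j hij => ⟨fun h => ?_⟩⟩
  · exact ⟨range (e i), countable_range _, (he i).denseRange⟩
  · ext1 x
    by_contra hx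
    obtain ⟨s, t, hs, hst⟩ := (he i).exists_mem_map_eq (fun s => hu (i, s)) (he i) h
      (O := {x | h x ≠ x}) (isOpen_ne_fun h.continuous continuous_id) ⟨x, hx⟩
    obtain rfl : s = t := (Prod.ext_iff.1 (key i i h s t hst)).2
    exact hs hst
  · obtain ⟨s, t, -, hst⟩ := (he i).exists_mem_map_eq (fun s => hu (j, s)) (he j) h
      isOpen_univ ⟨e i [], mem_univ _⟩
    exact hij (Prod.ext_iff.1 (key i j h s t hst)).1
end
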